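/- Let I be a countably complete ideal on κ and suppose there is a set D ⊆ I⁺ such that D is dense (every A ∈ I⁺ has B ∈ D with B ⊆_I A) and every ⊆_I-decreasing sequence of elements of D of length ω has a ⊆_I-lower bound in D. Then Player II has a winning strategy in the Galvin–Jech–Magidor ideal game on I; in particular, Player I has no winning strategy in that game. -/

import Mathlib

universe u

open Cardinal Set

namespace WelchPaper

variable {α : Type u}

/-- A `κ`-complete subalgebra of the powerset of `α` (thought of as `P(κ)`):
contains `∅` and `univ`, is closed under complements and under unions of
fewer than `κ` of its members. -/
def IsKappaSubalgebra (κ : Cardinal.{u}) (𝒜 : Set (Set α)) : Prop :=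
  ∅ ∈ 𝒜 ∧ Set.univ ∈ 𝒜 ∧ (∀ A ∈ 𝒜, Aᶜ ∈ 𝒜) ∧
    ∀ S : Set (Set α), S ⊆ 𝒜 → #S < κ → ⋃₀ S ∈ 𝒜

/-- A `κ`-algebra: a `κ`-complete subalgebra of `P(κ)` of cardinality `κ`. -/
def IsKappaAlgebra (κ : Cardinal.{u}) (𝒜 : Set (Set α)) : Prop :=
  IsKappaSubalgebra κ 𝒜 ∧ #𝒜 = κ

/-- An ultrafilter on the family `𝒜`. -/
def IsUltrafilterOn (𝒜 U : Set (Set α)) : Prop :=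
  U ⊆ 𝒜 ∧ ∅ ∉ U ∧ (∀ A ∈ U, ∀ B ∈ U, A ∩ B ∈ U) ∧
    (∀ A ∈ U, ∀ B ∈ 𝒜, A ⊆ B → B ∈ U) ∧
    ∀ A ∈ 𝒜, (A ∈ U ↔ Aᶜ ∉ U)

/-- `κ`-completeness of a filter/ultrafilter `U` on `𝒜`: every intersection of
fewer than `κ` members of `U` that belongs to `𝒜` lies in `U`. -/
def IsKappaCompleteOn (κ : Cardinal.{u}) (𝒜 U : Set (Set α)) : Prop :=
  ∀ S : Set (Set α), S ⊆ U → #S < κ → ⋂₀ S ∈ 𝒜 → ⋂₀ S ∈ U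

/-- Uniformity: every member has cardinality `κ`. -/
def IsUniformFam (κ : Cardinal.{u}) (U : Set (Set α)) : Prop :=
  ∀ A ∈ U, #A = κ

/-- Legality of Player I's move at stage `i` of the Welch game: the `i`-th move
is a `κ`-algebra containing all singletons and extending all previous moves. -/
def WelchLegalI (κ : Cardinal.{u}) (A : Ordinal.{u} → Set (Set α)) (i : Ordinal.{u}) : Prop :=
  IsKappaAlgebra κ (A i) ∧ (∀ x : α, {x} ∈ A i) ∧ ∀ j < i, A j ⊆ A i

/-- Legality of Player II's move at stage `i` of the Welch game: the `i`-th
response is a uniform `κ`-complete ultrafilter on the `i`-th algebra extending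
all previous responses. -/
def WelchLegalII (κ : Cardinal.{u}) (A U : Ordinal.{u} → Set (Set α)) (i : Ordinal.{u}) : Prop :=
  IsUltrafilterOn (A i) (U i) ∧ IsKappaCompleteOn κ (A i) (U i) ∧ IsUniformFam κ (U i) ∧
    ∀ j < i, U j ⊆ U i

/-- `σ` is a winning strategy for Player II in the Welch game of length `γ` on
`κ`.  A strategy is represented as a function assigning to (the sequence of)
Player I's moves the responses of Player II; it may only depend on Player I's
moves made so far.  It is winning if along any run in which Player I moves
legally, all responses of `σ` are legal. -/
def IsWinningWelchII (κ : Cardinal.{u}) (γ : Ordinal.{u})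
    (σ : (Ordinal.{u} → Set (Set α)) → Ordinal.{u} → Set (Set α)) : Prop :=
  (∀ A A' : Ordinal.{u} → Set (Set α), ∀ i, (∀ j ≤ i, A j = A' j) → σ A i = σ A' i) ∧
    ∀ A : Ordinal.{u} → Set (Set α), (∀ i < γ, WelchLegalI κ A i) →
      ∀ i < γ, WelchLegalII κ A (σ A) i

/-- The smallest `κ`-complete subalgebra of `P(κ)` containing `B`. -/
def genAlgebra (κ : Cardinal.{u}) (B : Set (Set α)) : Set (Set α) :=
  ⋂₀ {𝒜 : Set (Set α) | IsKappaSubalgebra κ 𝒜 ∧ B ⊆ 𝒜}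

/-- The payoff `Q_γ`: the run `⟨A i, U i : i < γ⟩` admits a `κ`-complete
ultrafilter on the smallest `κ`-complete subalgebra containing `⋃_{i<γ} A i`
extending every `U i`. -/
def RunInQ (κ : Cardinal.{u}) (γ : Ordinal.{u}) (A U : Ordinal.{u} → Set (Set α)) : Prop :=
  ∃ W : Set (Set α),
    IsUltrafilterOn (genAlgebra κ (⋃ i ∈ Set.Iio γ, A i)) W ∧
    IsKappaCompleteOn κ (genAlgebra κ (⋃ i ∈ Set.Iio γ, A i)) W ∧
    ∀ i < γ, U i ⊆ W

/-- A winning strategy for Player II in the Welch game of length `γ` with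
payoff `Q_γ`: it is winning, and moreover every run played according to it
lies in `Q_γ`. -/
def IsWinningWelchIIQ (κ : Cardinal.{u}) (γ : Ordinal.{u})
    (σ : (Ordinal.{u} → Set (Set α)) → Ordinal.{u} → Set (Set α)) : Prop :=
  IsWinningWelchII κ γ σ ∧
    ∀ A : Ordinal.{u} → Set (Set α), (∀ i < γ, WelchLegalI κ A i) → RunInQ κ γ A (σ A)

/-- An ideal on `α`. -/
def IsIdeal (I : Set (Set α)) : Prop :=
  ∅ ∈ I ∧ Set.univ ∉ I ∧ (∀ A ∈ I, ∀ B : Set α, B ⊆ A → B ∈ I) ∧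
    ∀ A ∈ I, ∀ B ∈ I, A ∪ B ∈ I

/-- `κ`-completeness of an ideal: closed under unions of fewer than `κ` members. -/
def IdealKappaComplete (κ : Cardinal.{u}) (I : Set (Set α)) : Prop :=
  ∀ S : Set (Set α), S ⊆ I → #S < κ → ⋃₀ S ∈ I

/-- Uniformity of an ideal: all sets of cardinality `< κ` belong to it. -/
def IdealUniform (κ : Cardinal.{u}) (I : Set (Set α)) : Prop :=
  ∀ A : Set α, #A < κ → A ∈ I

/-- Normality of an ideal: closed under diagonal unions. -/
def IdealNormal [LT α] (I : Set (Set α)) : Prop :=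
  ∀ A : α → Set α, (∀ ξ, A ξ ∈ I) → {β : α | ∃ ξ < β, β ∈ A ξ} ∈ I

/-- `κ⁺`-saturation: among any `κ⁺` many `I`-positive sets there are two whose
intersection is `I`-positive. -/
def IdealSaturated (κ : Cardinal.{u}) (I : Set (Set α)) : Prop :=
  ∀ W : Set (Set α), (∀ A ∈ W, A ∉ I) → #W = Order.succ κ →
    ∃ A ∈ W, ∃ B ∈ W, A ≠ B ∧ A ∩ B ∉ I

/-- `α` (of size `κ`) carries a saturated ideal: a uniform `κ`-complete
`κ⁺`-saturated ideal. -/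
def CarriesSaturatedIdeal (κ : Cardinal.{u}) (α : Type u) : Prop :=
  ∃ I : Set (Set α), IsIdeal I ∧ IdealKappaComplete κ I ∧ IdealUniform κ I ∧
    IdealSaturated κ I

/-- `τ` is a winning strategy for Player I in the Galvin–Jech–Magidor ideal
game on `I`: Player I plays `A n = τ B n` (depending only on Player II's moves
`B j`, `j < n`); his moves are legal whenever Player II has played legally so
far, and whenever Player II plays legally throughout, `⋂ n, B n = ∅`. -/
def IdealGameWinningI (I : Set (Set α)) (τ : (ℕ → Set α) → ℕ → Set α) : Prop :=
  (∀ B B' : ℕ → Set α, ∀ n, (∀ j < n, B j = B' j) → τ B n = τ B' n) ∧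
  (∀ B : ℕ → Set α, ∀ n, (∀ j < n, B j ∉ I ∧ B j ⊆ τ B j) →
      τ B n ∉ I ∧ ∀ m, n = m + 1 → τ B n ⊆ B m) ∧
  ∀ B : ℕ → Set α, (∀ n, B n ∉ I ∧ B n ⊆ τ B n) → ⋂ n, B n = ∅

/-- `ρ` is a winning strategy for Player II in the Galvin–Jech–Magidor ideal
game on `I`: Player II plays `B n = ρ A n` (depending only on Player I's moves
`A j`, `j ≤ n`); her moves are legal whenever Player I has played legally so
far, and whenever Player I plays legally throughout, `⋂ n, B n ≠ ∅`. -/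
def IdealGameWinningII (I : Set (Set α)) (ρ : (ℕ → Set α) → ℕ → Set α) : Prop :=
  (∀ A A' : ℕ → Set α, ∀ n, (∀ j ≤ n, A j = A' j) → ρ A n = ρ A' n) ∧
  (∀ A : ℕ → Set α, ∀ n, (∀ j ≤ n, A j ∉ I ∧ ∀ m, j = m + 1 → A j ⊆ ρ A m) →
      ρ A n ∉ I ∧ ρ A n ⊆ A n) ∧
  ∀ A : ℕ → Set α, (∀ n, A n ∉ I ∧ ∀ m, n = m + 1 → A n ⊆ ρ A m) →
    (⋂ n, ρ A n).Nonempty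

end WelchPaper

namespace WelchPaper

/-- The run in which Player II answers every move `A` by `F A` against the strategy `τ`. -/
noncomputable def playAgainst {α : Type u} (F : Set α → Set α)
    (τ : (ℕ → Set α) → ℕ → Set α) (n : ℕ) : Set α :=
  F (τ (fun k => if _h : k < n then playAgainst F τ k else ∅) n)
termination_by n

/-- If `I` is a countably complete ideal on `κ` and
`D ⊆ I⁺` is dense and closed under `⊆_I`-decreasing `ω`-sequences, then
Player II has a winning strategy in the Galvin–Jech–Magidor ideal game on
`I`; in particular Player I has no winning strategy. -/
theorem dense_sigma_closed_implies_ideal_game (α : Type u) (I : Set (Set α))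
    (hI : IsIdeal I)
    (hcc : ∀ S : Set (Set α), S ⊆ I → S.Countable → ⋃₀ S ∈ I)
    (D : Set (Set α)) (hDpos : ∀ d ∈ D, d ∉ I)
    (hdense : ∀ A : Set α, A ∉ I → ∃ B ∈ D, B \ A ∈ I)
    (hclosed : ∀ f : ℕ → Set α, (∀ n, f n ∈ D) → (∀ m n : ℕ, m ≤ n → f n \ f m ∈ I) →
      ∃ d ∈ D, ∀ n, d \ f n ∈ I) :
    (∃ ρ : (ℕ → Set α) → ℕ → Set α, IdealGameWinningII I ρ) ∧
      ¬ ∃ τ : (ℕ → Set α) → ℕ → Set α, IdealGameWinningI I τ := by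
  obtain ⟨-, -, hsub, hun⟩ := hI
  choose! g hgD hgI using hdense
  have key : ∀ A, A ∉ I → A ∩ g A ∉ I := by
    intro A hA h
    refine hDpos _ (hgD A hA) (hsub _ (hun _ h _ (hgI A hA)) _ ?_)
    intro x hx
    by_cases hxA : x ∈ A
    · exact Or.inl ⟨hxA, hx⟩
    · exact Or.inr ⟨hx, hxA⟩
  have win : ∀ A : ℕ → Set α,
      (∀ n, A n ∉ I ∧ ∀ m, n = m + 1 → A n ⊆ A m ∩ g (A m)) →
      (⋂ n, A n ∩ g (A n)).Nonempty := by
    intro A hA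
    have hanti : Antitone A :=
      antitone_nat_of_succ_le fun n x hx => ((hA (n + 1)).2 n rfl hx).1
    obtain ⟨d, hdD, hd⟩ := hclosed (fun n => g (A n)) (fun n => hgD _ (hA n).1) (by
      intro m n hmn
      refine hsub _ (hgI _ (hA n).1) _ ?_
      rintro x ⟨hx, hxm⟩
      refine ⟨hx, fun hxA => ?_⟩
      rcases hmn.eq_or_lt with rfl | hlt
      · exact hxm hx
      · exact hxm ((hA (m + 1)).2 m rfl (hanti hlt hxA)).2)
    by_contra hne
    rw [Set.not_nonempty_iff_eq_empty] at hne
    refine hDpos d hdD (hsub _ (hcc (Set.range fun n => d \ (A n ∩ g (A n))) ?_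
      (Set.countable_range _)) d ?_)
    · rintro _ ⟨n, rfl⟩
      refine hsub _ (hun _ (hd n) _ (hgI _ (hA n).1)) _ ?_
      rintro x ⟨hx, hx'⟩
      by_cases hg : x ∈ g (A n)
      · exact Or.inr ⟨hg, fun h => hx' ⟨h, hg⟩⟩
      · exact Or.inl ⟨hx, hg⟩
    · intro x hx
      have : x ∉ ⋂ n, A n ∩ g (A n) := by rw [hne]; exact fun h => h
      rw [Set.mem_iInter, not_forall] at this
      obtain ⟨n, hn⟩ := this
      exact ⟨_, ⟨n, rfl⟩, hx, hn⟩
  refine ⟨⟨fun A n => A n ∩ g (A n), ?_, ?_, win⟩, ?_⟩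
  · intro A A' n h
    simp only [h n le_rfl]
  · intro A n h
    exact ⟨key _ (h n le_rfl).1, Set.inter_subset_left⟩
  · rintro ⟨τ, hloc, hleg, hwin⟩
    let B : ℕ → Set α := playAgainst (fun A => A ∩ g A) τ
    have hB : ∀ n, B n = τ B n ∩ g (τ B n) := by
      intro n
      have e : τ B n = τ (fun k => if _h : k < n then B k else ∅) n :=
        hloc _ _ _ fun j hj => by simp [hj]
      rw [e]
      change playAgainst _ τ n = _
      rw [playAgainst]
    have hBleg : ∀ n, B n ∉ I ∧ B n ⊆ τ B n := by
      intro n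
      induction n using Nat.strong_induction_on with
      | _ n ih =>
        have h := (hleg B n ih).1
        rw [hB n]
        exact ⟨key _ h, Set.inter_subset_left⟩
    have hne := win (fun n => τ B n) (fun n => by
      have h := hleg B n fun j _ => hBleg j
      refine ⟨h.1, fun m hm => ?_⟩
      rw [← hB m]
      exact h.2 m hm)
    simp only [← hB] at hne
    rw [hwin B hBleg] at hne
    exact Set.not_nonempty_empty hne

end WelchPaper
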